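/- If a C*-algebra A contains an infinite projection, then A has an irreducible representation whose image does not lie in the compact operators; consequently A does not have continuous trace. -/

import Mathlib

/-- A representation `π` of a C*-algebra on a Hilbert space is (topologically)
irreducible if the only closed invariant subspaces are `⊥` and `⊤`. -/
def IsIrreducibleRep {A H : Type} [CStarAlgebra A]
    [NormedAddCommGroup H] [InnerProductSpace ℂ H] [CompleteSpace H]
    (π : A →⋆ₐ[ℂ] (H →L[ℂ] H)) : Prop :=
  ∀ K : Submodule ℂ H, IsClosed (K : Set H) →
    (∀ (a : A), ∀ x ∈ K, π a x ∈ K) → K = ⊥ ∨ K = ⊤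

section AuxLemmas
open scoped ComplexOrder InnerProductSpace

theorem aux_compact {H : Type} [NormedAddCommGroup H] [InnerProductSpace ℂ H] [CompleteSpace H]
    (P V W : H →L[ℂ] H) (hP : IsCompactOperator P) (hPP : P * P = P) (hWV : W * V = P)
    (hVP : V * P = V) (hPV : P * V = V) (hWP : V * W * P = V * W) : V * W = P := by
  have e : ∀ (S T : H →L[ℂ] H) x, (S * T) x = S (T x) := fun _ _ _ => rfl
  have hK : IsClosed (P.toLinearMap.eqLocus (LinearMap.id) : Set H) :=
    isClosed_eq P.continuous continuous_id
  set K : Submodule ℂ H := P.toLinearMap.eqLocus (LinearMap.id) with hKdef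
  have mem : ∀ x, x ∈ K ↔ P x = x := fun x => Iff.rfl
  have hc : IsCompactOperator (P.toLinearMap.restrict (p := K) (q := K)
      (fun x hx => by rw [mem] at hx ⊢; change P (P x) = P x; rw [hx, hx])) :=
    hP.restrict _ hK
  have hid : FiniteDimensional ℂ K := by
    apply FiniteDimensional.of_isCompactOperator_id (𝕜 := ℂ)
    have : (id : K → K) = (P.toLinearMap.restrict (p := K) (q := K)
      (fun x hx => by rw [mem] at hx ⊢; change P (P x) = P x; rw [hx, hx])) := by
      funext x
      exact Subtype.ext ((mem _).1 x.2).symm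
    rw [this]
    exact hc
  have hVK : ∀ x ∈ K, V x ∈ K := fun x _ => by rw [mem, ← e, hPV]
  let VK := V.toLinearMap.restrict hVK
  have hinj : Function.Injective VK := by
    rw [← LinearMap.ker_eq_bot, LinearMap.ker_eq_bot']
    intro x hx
    have h1 : V x = 0 := congrArg Subtype.val hx
    ext
    rw [← (mem _).1 x.2, ← hWV, e, h1]; simp
  have hsurj := LinearMap.surjective_of_injective hinj
  ext z
  have hz : P z ∈ K := by rw [mem, ← e, hPP]
  obtain ⟨x, hx⟩ := hsurj ⟨P z, hz⟩
  have h1 : V x = P z := congrArg Subtype.val hx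
  rw [← hWP, e, ← h1, e, ← e W V, hWV, ← e, hVP]

theorem aux_gns {A : Type} [CStarAlgebra A] (φ : A →L[ℂ] ℂ) (h1 : φ 1 = 1) (hn : ‖φ‖ ≤ 1) :
    ∃ (H : Type) (_ : NormedAddCommGroup H) (_ : InnerProductSpace ℂ H)
      (_ : CompleteSpace H) (π : A →⋆ₐ[ℂ] (H →L[ℂ] H)) (ξ : H),
      (∀ a, ⟪ξ, π a ξ⟫_ℂ = φ a) ∧ Dense (Set.range fun a => π a ξ) := by
  let _ := CStarAlgebra.spectralOrder A
  have _ := CStarAlgebra.spectralOrderedRing A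
  have hb : ∀ a, ‖φ a‖ ≤ ‖a‖ := fun a => by
    simpa using φ.le_of_opNorm_le hn a
  have hnt : Nontrivial A := by
    refine ⟨1, 0, fun h => ?_⟩
    rw [h, map_zero] at h1; exact zero_ne_one h1
  have hreal : ∀ a : A, IsSelfAdjoint a → (φ a).im = 0 := by
    intro a ha
    have key : ∀ t : ℝ, 2 * t * (φ a).im ≤ ‖a‖ ^ 2 := by
      intro t
      have h2 : ‖a + (Complex.I * t) • (1 : A)‖ ^ 2 ≤ ‖a‖ ^ 2 + t ^ 2 := by
        rw [sq, ← CStarRing.norm_star_mul_self]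
        have : star (a + (Complex.I * t) • (1 : A)) * (a + (Complex.I * t) • (1 : A))
            = a * a + ((t : ℂ) ^ 2) • (1 : A) := by
          simp only [star_add, star_smul, star_one, ha.star_eq, add_mul, mul_add,
            smul_mul_assoc, mul_smul_comm, one_mul, mul_one, RCLike.star_def, map_mul,
            Complex.conj_I, Complex.conj_ofReal]
          have : (-Complex.I * (t:ℂ)) * (Complex.I * t) = (t:ℂ)^2 := by
            linear_combination (-(t:ℂ)^2) * Complex.I_sq
          rw [smul_add, smul_smul, mul_comm (Complex.I * (t:ℂ)), this]
          module
        rw [this]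
        refine (norm_add_le _ _).trans ?_
        gcongr
        · rw [sq]; exact norm_mul_le _ _
        · rw [norm_smul]; simp
      have h3 := hb (a + (Complex.I * t) • (1 : A))
      rw [map_add, map_smul, h1] at h3
      have h4 : ‖φ a + (Complex.I * t) • (1:ℂ)‖ ^ 2 ≤ ‖a‖ ^ 2 + t ^ 2 :=
        le_trans (by gcongr) h2
      rw [← Complex.normSq_eq_norm_sq, Complex.normSq_apply] at h4
      simp at h4
      nlinarith [sq_nonneg (φ a).re, sq_nonneg (φ a).im]
    by_contra hne
    have := key ((‖a‖ ^ 2 + 1) / (2 * (φ a).im))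
    have h5 : 2 * ((‖a‖ ^ 2 + 1) / (2 * (φ a).im)) * (φ a).im = ‖a‖ ^ 2 + 1 := by
      field_simp
    linarith
  have hpos : ∀ a : A, 0 ≤ a → 0 ≤ φ a := by
    intro a ha
    have him := hreal a ha.isSelfAdjoint
    have h2 : ‖(‖a‖ : ℂ) • (1:A) - a‖ ≤ ‖a‖ := by
      have h0 : 0 ≤ (‖a‖ : ℂ) • (1:A) - a := by
        rw [sub_nonneg]
        have := (IsSelfAdjoint.of_nonneg ha).le_algebraMap_norm_self
        rw [Algebra.algebraMap_eq_smul_one] at this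
        simpa using this
      rw [CStarAlgebra.norm_le_iff_le_algebraMap _ (norm_nonneg a) h0]
      rw [Algebra.algebraMap_eq_smul_one]
      simpa using ha
    have h3 := (hb _).trans h2
    rw [map_sub, map_smul, h1] at h3
    have h4 := (Complex.re_le_norm _).trans h3
    simp at h4
    rw [Complex.nonneg_iff]
    exact ⟨h4, him.symm⟩
  let f : A →ₚ[ℂ] ℂ := PositiveLinearMap.mk₀ φ.toLinearMap hpos
  refine ⟨f.GNS, inferInstance, inferInstance, inferInstance, f.gnsStarAlgHom,
    ((f.toPreGNS 1 : f.PreGNS) : f.GNS), ?_, ?_⟩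
  · intro a
    change ⟪_, f.gnsNonUnitalStarAlgHom a _⟫_ℂ = _
    rw [PositiveLinearMap.gnsNonUnitalStarAlgHom_apply_coe, UniformSpace.Completion.inner_coe,
      PositiveLinearMap.preGNS_inner_def]
    simp
    rfl
  · have : (fun a => f.gnsStarAlgHom a ((f.toPreGNS 1 : f.PreGNS) : f.GNS))
        = (fun x : f.PreGNS => (x : f.GNS)) ∘ f.toPreGNS := by
      funext a
      change f.gnsNonUnitalStarAlgHom a _ = _
      rw [PositiveLinearMap.gnsNonUnitalStarAlgHom_apply_coe]
      simp
    rw [this, Set.range_comp, f.toPreGNS.surjective.range_eq, Set.image_univ]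
    exact UniformSpace.Completion.denseRange_coe

theorem aux_ext {A : Type} [CStarAlgebra A] (q : A) (hq : ‖q‖ = 1) :
    ∃ φ : A →L[ℂ] ℂ, φ ∈ Set.extremePoints ℝ {φ : A →L[ℂ] ℂ | ‖φ‖ ≤ 1 ∧ φ q = 1} := by
  have hex : ({φ : WeakDual ℂ A | φ ∈ WeakDual.toStrongDual ⁻¹' Metric.closedBall 0 1 ∧ φ q = 1}).Nonempty := by
    obtain ⟨g, hg, hgq⟩ := exists_dual_vector ℂ q (by rw [← norm_ne_zero_iff, hq]; simp)
    exact ⟨StrongDual.toWeakDual g, by simp [hg], by simpa [hq] using hgq⟩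
  have hcomp : IsCompact {φ : WeakDual ℂ A | φ ∈ WeakDual.toStrongDual ⁻¹' Metric.closedBall 0 1 ∧ φ q = 1} :=
    (WeakDual.isCompact_closedBall 0 1).inter_right
      (isClosed_eq (WeakDual.eval_continuous q) continuous_const)
  have : LocallyConvexSpace ℝ (WeakDual ℂ A) :=
    (LinearMap.weakBilin_withSeminorms (topDualPairing ℂ A)).toLocallyConvexSpace
  obtain ⟨φ, hφ⟩ := hcomp.extremePoints_nonempty hex
  rw [mem_extremePoints] at hφ
  refine ⟨WeakDual.toStrongDual φ, ?_⟩
  rw [mem_extremePoints]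
  refine ⟨⟨by simpa using hφ.1.1, hφ.1.2⟩, ?_⟩
  intro x hx y hy hxy
  have := hφ.2 (StrongDual.toWeakDual x) ⟨by simpa using hx.1, hx.2⟩
    (StrongDual.toWeakDual y) ⟨by simpa using hy.1, hy.2⟩ hxy
  exact this

theorem aux_one {A : Type} [CStarAlgebra A] (q : A) (hq : IsSelfAdjoint q) (hqq : q * q = q)
    (φ : A →L[ℂ] ℂ) (hn : ‖φ‖ ≤ 1) (h : φ q = 1) : φ 1 = 1 := by
  have hnt : Nontrivial A := by
    refine ⟨q, 0, fun h0 => ?_⟩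
    rw [h0, map_zero] at h; exact zero_ne_one h
  by_contra hne
  set c := φ 1 - 1 with hc
  have hc0 : c ≠ 0 := sub_ne_zero.2 hne
  have hcn : (‖c‖ : ℂ) ≠ 0 := by simpa using hc0
  set l : ℂ := star c / ‖c‖ with hl
  have hcc : star c * c = (‖c‖ : ℂ) ^ 2 := by
    rw [RCLike.star_def, Complex.conj_mul']
  have hll : star l * l = 1 := by
    rw [hl, star_div₀, star_star]
    simp only [RCLike.star_def, Complex.conj_ofReal] at hcc ⊢
    field_simp
    rw [mul_comm, hcc]
  have hx : star (q + l • (1 - q)) * (q + l • (1 - q)) = 1 := by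
    simp only [star_add, star_smul, star_sub, star_one, hq.star_eq, add_mul, mul_add,
      smul_mul_assoc, mul_smul_comm, sub_mul, mul_sub, one_mul, mul_one, hqq, sub_self,
      smul_zero, add_zero]
    rw [add_sub_cancel_left, smul_smul, mul_comm l, hll]
    simp
  have hx1 : ‖q + l • (1 - q)‖ = 1 := by
    have : ‖q + l • (1 - q)‖ * ‖q + l • (1 - q)‖ = 1 := by
      rw [← CStarRing.norm_star_mul_self, hx, norm_one]
    nlinarith [norm_nonneg (q + l • (1 - q))]
  have h2 := φ.le_of_opNorm_le hn (q + l • (1 - q))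
  rw [hx1, map_add, map_smul, map_sub, h, ← hc] at h2
  have h3 : l • c = (‖c‖ : ℂ) := by
    rw [smul_eq_mul, hl]
    field_simp
    rw [mul_comm]
    simpa [mul_comm] using hcc
  rw [h3, ← Complex.ofReal_one, ← Complex.ofReal_add, Complex.norm_real, Real.norm_eq_abs,
    abs_of_nonneg (by positivity)] at h2
  have : 0 < ‖c‖ := norm_pos_iff.2 hc0
  linarith

theorem aux_vec {A H : Type} [CStarAlgebra A] [NormedAddCommGroup H] [InnerProductSpace ℂ H]
    [CompleteSpace H] (π : A →⋆ₐ[ℂ] (H →L[ℂ] H)) (x : H) (hx : x ≠ 0) :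
    ∃ ψ : A →L[ℂ] ℂ, ‖ψ‖ ≤ 1 ∧ ∀ a, ((‖x‖ ^ 2 : ℝ) : ℂ) * ψ a = ⟪x, π a x⟫_ℂ := by
  have hx0 : 0 < ‖x‖ := norm_pos_iff.2 hx
  let L : A →ₗ[ℂ] ℂ :=
    { toFun := fun a => ((‖x‖ ^ 2 : ℝ) : ℂ)⁻¹ * ⟪x, π a x⟫_ℂ
      map_add' := fun a b => by
        simp only [map_add, add_apply, inner_add_right, mul_add]
      map_smul' := fun c a => by
        simp only [map_smul, smul_apply, inner_smul_right, smul_eq_mul,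
          RingHom.id_apply]
        ring }
  refine ⟨L.mkContinuous 1 ?_, LinearMap.mkContinuous_norm_le _ zero_le_one _, ?_⟩
  · intro a
    change ‖((‖x‖ ^ 2 : ℝ) : ℂ)⁻¹ * ⟪x, π a x⟫_ℂ‖ ≤ _
    rw [norm_mul, norm_inv, Complex.norm_real, Real.norm_eq_abs, abs_of_nonneg (by positivity),
      inv_mul_le_iff₀ (by positivity)]
    calc ‖⟪x, π a x⟫_ℂ‖ ≤ ‖x‖ * ‖π a x‖ := norm_inner_le_norm _ _
      _ ≤ ‖x‖ * (‖π a‖ * ‖x‖) := by gcongr; exact (π a).le_opNorm x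
      _ ≤ ‖x‖ * (‖a‖ * ‖x‖) := by gcongr; exact NonUnitalStarAlgHom.norm_apply_le π a
      _ = _ := by ring
  · intro a
    change _ * (((‖x‖ ^ 2 : ℝ) : ℂ)⁻¹ * ⟪x, π a x⟫_ℂ) = _
    rw [mul_inv_cancel_left₀]
    exact_mod_cast (pow_pos hx0 2).ne'

theorem aux_irr {A : Type} [CStarAlgebra A] (q : A) (hq : IsSelfAdjoint q) (hqq : q * q = q)
    (hq0 : q ≠ 0) :
    ∃ (H : Type) (_ : NormedAddCommGroup H) (_ : InnerProductSpace ℂ H)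
      (_ : CompleteSpace H) (π : A →⋆ₐ[ℂ] (H →L[ℂ] H)), IsIrreducibleRep π ∧ π q ≠ 0 := by
  have hqn : ‖q‖ = 1 := by
    have h1 : ‖q‖ * ‖q‖ = ‖q‖ := by
      rw [← CStarRing.norm_star_mul_self, hq.star_eq, hqq]
    exact mul_left_cancel₀ (norm_ne_zero_iff.2 hq0) (by rw [h1, mul_one])
  obtain ⟨φ, hφ⟩ := aux_ext q hqn
  rw [mem_extremePoints] at hφ
  obtain ⟨⟨hn, hφq⟩, hext⟩ := hφ
  have hφ1 := aux_one q hq hqq φ hn hφq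
  obtain ⟨H, _, _, _, π, ξ, hξ, hd⟩ := aux_gns φ hφ1 hn
  refine ⟨H, _, _, _, π, ?_, fun h0 => ?_⟩
  swap
  · have := hξ q
    rw [h0, hφq] at this
    simp at this
  have hadj : ∀ a x y, ⟪π a x, y⟫_ℂ = ⟪x, π (star a) y⟫_ℂ := by
    intro a x y
    rw [map_star, ContinuousLinearMap.star_eq_adjoint, ContinuousLinearMap.adjoint_inner_right]
  have hmul : ∀ a b x, π (a * b) x = π a (π b x) := fun a b x => by rw [map_mul]; rfl
  have hξξ : ⟪ξ, ξ⟫_ℂ = 1 := by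
    have := hξ 1
    rwa [map_one, hφ1] at this
  have hqξ : π q ξ = ξ := by
    rw [← sub_eq_zero, ← inner_self_eq_zero (𝕜 := ℂ)]
    have e1 : ⟪π q ξ, π q ξ⟫_ℂ = 1 := by rw [hadj, hq.star_eq, ← hmul, hqq, hξ, hφq]
    have e2 : ⟪π q ξ, ξ⟫_ℂ = 1 := by rw [hadj, hq.star_eq, hξ, hφq]
    rw [inner_sub_left, inner_sub_right, inner_sub_right, e1, e2, hξ, hφq, hξξ]
    ring
  intro K hK hinv
  have : CompleteSpace K := hK.completeSpace_coe
  have hinv' : ∀ (a : A), ∀ x ∈ Kᗮ, π a x ∈ Kᗮ := by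
    intro a x hx
    rw [Submodule.mem_orthogonal] at hx ⊢
    intro u hu
    rw [← star_star a, ← hadj]
    exact hx _ (hinv _ _ hu)
  have full : ∀ M : Submodule ℂ H, IsClosed (M : Set H) → (∀ (a : A), ∀ x ∈ M, π a x ∈ M) →
      ξ ∈ M → M = ⊤ := by
    intro M hM hi hm
    rw [eq_top_iff]
    intro x _
    have : closure (Set.range fun a => π a ξ) ⊆ M :=
      hM.closure_subset_iff.2 (by rintro _ ⟨a, rfl⟩; exact hi a _ hm)
    exact this (hd x)
  obtain ⟨η, hη, ζ, hζ, hsum⟩ := K.exists_add_mem_mem_orthogonal ξ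
  by_cases hη0 : η = 0
  · left
    rw [hη0, zero_add] at hsum
    have := full Kᗮ K.isClosed_orthogonal hinv' (hsum ▸ hζ)
    rwa [Submodule.orthogonal_eq_top_iff] at this
  right
  by_cases hζ0 : ζ = 0
  · rw [hζ0, add_zero] at hsum
    exact full K hK hinv (hsum ▸ hη)
  exfalso
  have o1 : ∀ x ∈ K, ∀ y ∈ Kᗮ, ⟪x, y⟫_ℂ = 0 := fun x hx y hy =>
    Submodule.inner_right_of_mem_orthogonal hx hy
  have o2 : ∀ x ∈ K, ∀ y ∈ Kᗮ, ⟪y, x⟫_ℂ = 0 := fun x hx y hy =>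
    Submodule.inner_left_of_mem_orthogonal hx hy
  have hd1 : π q η - η = ζ - π q ζ := by
    have := hqξ
    rw [hsum, map_add] at this
    rw [sub_eq_sub_iff_add_eq_add, this, add_comm]
  have hd2 : π q η - η = 0 := by
    rw [← inner_self_eq_zero (𝕜 := ℂ)]
    nth_rw 2 [hd1]
    exact o1 _ (K.sub_mem (hinv _ _ hη) hη) _ (Kᗮ.sub_mem hζ (hinv' _ _ hζ))
  have hqη : π q η = η := sub_eq_zero.1 hd2
  have hqζ : π q ζ = ζ := (sub_eq_zero.1 (hd1.symm.trans hd2)).symm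
  obtain ⟨ψ₁, hψ₁, hv₁⟩ := aux_vec π η hη0
  obtain ⟨ψ₂, hψ₂, hv₂⟩ := aux_vec π ζ hζ0
  have hq' : ∀ (x : H) (ψ : A →L[ℂ] ℂ), x ≠ 0 → π q x = x →
      (∀ a, ((‖x‖ ^ 2 : ℝ) : ℂ) * ψ a = ⟪x, π a x⟫_ℂ) → ψ q = 1 := by
    intro x ψ hx hqx hv
    have h := hv q
    rw [hqx, inner_self_eq_norm_sq_to_K] at h
    have h0 : ((‖x‖ ^ 2 : ℝ) : ℂ) ≠ 0 := by
      exact_mod_cast (pow_pos (norm_pos_iff.2 hx) 2).ne'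
    apply mul_left_cancel₀ h0
    rw [h]; simp
  have hφsum : ∀ a, φ a = ((‖η‖ ^ 2 : ℝ) : ℂ) * ψ₁ a + ((‖ζ‖ ^ 2 : ℝ) : ℂ) * ψ₂ a := by
    intro a
    rw [← hξ, hv₁, hv₂, hsum, map_add, inner_add_left, inner_add_right, inner_add_right,
      o1 _ hη _ (hinv' a _ hζ), o2 _ (hinv a _ hη) _ hζ]
    ring
  have p1 := hq' η ψ₁ hη0 hqη hv₁
  have p2 := hq' ζ ψ₂ hζ0 hqζ hv₂
  have hts : ‖η‖ ^ 2 + ‖ζ‖ ^ 2 = 1 := by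
    have := hφsum q
    rw [p1, p2, hφq, mul_one, mul_one] at this
    exact_mod_cast this.symm
  have hseg : φ ∈ openSegment ℝ ψ₁ ψ₂ := by
    refine ⟨‖η‖ ^ 2, ‖ζ‖ ^ 2, pow_pos (norm_pos_iff.2 hη0) 2, pow_pos (norm_pos_iff.2 hζ0) 2,
      hts, ?_⟩
    ext a
    rw [hφsum]
    simp
  have heq : ψ₁ = φ := (hext ψ₁ ⟨hψ₁, p1⟩ ψ₂ ⟨hψ₂, p2⟩ hseg).1
  have hfin : η - ((‖η‖ ^ 2 : ℝ) : ℂ) • ξ = 0 := by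
    apply hd.eq_zero_of_inner_left ℂ
    rintro _ ⟨a, rfl⟩
    simp only
    rw [inner_sub_left, inner_smul_left, hξ, Complex.conj_ofReal]
    nth_rw 1 [hsum]
    rw [map_add, inner_add_right, o1 _ hη _ (hinv' a _ hζ), ← hv₁, heq]
    ring
  have hξK : ξ ∈ K := by
    have h0 : ((‖η‖ ^ 2 : ℝ) : ℂ) ≠ 0 := by
      exact_mod_cast (pow_pos (norm_pos_iff.2 hη0) 2).ne'
    rw [← inv_smul_smul₀ h0 ξ, ← sub_eq_zero.1 hfin]
    exact K.smul_mem _ hη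
  apply hζ0
  have hζK : ζ ∈ K := by
    rw [← add_sub_cancel_left η ζ, ← hsum]
    exact K.sub_mem hξK hη
  exact inner_self_eq_zero.1 (o1 ζ hζK ζ hζ)

end AuxLemmas

/-- If a C*-algebra `A` contains an infinite projection (a
projection `p` Murray–von Neumann equivalent, via `v`, to a proper
subprojection `v v* < p`), then `A` has an irreducible representation whose
image does not lie in the compact operators; consequently it is not the case
that every irreducible representation of `A` maps into the compacts (as it
would if `A` had continuous trace). -/
theorem no_continuous_trace_of_infinite_projection (A : Type) [CStarAlgebra A]
    (p v : A) (hp_sa : IsSelfAdjoint p) (hp_idem : p * p = p)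
    (hv : star v * v = p) (hsub : (v * star v) * p = v * star v)
    (hproper : v * star v ≠ p) :
    (∃ (H : Type) (_ : NormedAddCommGroup H) (_ : InnerProductSpace ℂ H)
      (_ : CompleteSpace H) (π : A →⋆ₐ[ℂ] (H →L[ℂ] H)),
      IsIrreducibleRep π ∧ ∃ a : A, ¬IsCompactOperator (π a)) ∧
    ¬(∀ (H : Type) (_ : NormedAddCommGroup H) (_ : InnerProductSpace ℂ H)
        (_ : CompleteSpace H) (π : A →⋆ₐ[ℂ] (H →L[ℂ] H)),
        IsIrreducibleRep π → ∀ a : A, IsCompactOperator (π a)) := by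
  have hstar : star (v * star v) = v * star v := by simp
  have hsub' : p * (v * star v) = v * star v := by
    have := congrArg star hsub
    rwa [star_mul, hstar, hp_sa.star_eq] at this
  have hvp : v * p = v := by
    have h : star (v * p - v) * (v * p - v) = 0 := by
      have e1 : star (v * p - v) * (v * p - v)
          = p * (star v * v) * p - p * (star v * v) - (star v * v) * p + star v * v := by
        rw [star_sub, star_mul, hp_sa.star_eq]
        noncomm_ring
      rw [e1, hv, hp_idem, hp_idem]
      noncomm_ring
    rw [CStarRing.star_mul_self_eq_zero_iff] at h
    exact sub_eq_zero.1 h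
  have hpv : p * v = v := by
    calc p * v = p * (v * (star v * v)) := by rw [hv, hvp]
      _ = (p * (v * star v)) * v := by simp only [mul_assoc]
      _ = v * (star v * v) := by rw [hsub', mul_assoc]
      _ = v := by rw [hv, hvp]
  have hqq : (p - v * star v) * (p - v * star v) = p - v * star v := by
    have e2 : (v * star v) * (v * star v) = v * star v := by
      calc _ = (v * (star v * v)) * star v := by simp only [mul_assoc]
        _ = _ := by rw [hv, hvp]
    rw [sub_mul, mul_sub, mul_sub, hp_idem, hsub, hsub', e2]
    simp
  obtain ⟨H, i1, i2, i3, π, hirr, hπ⟩ := aux_irr (p - v * star v)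
    (hp_sa.sub hstar) hqq (sub_ne_zero.2 hproper.symm)
  have hnc : ¬ IsCompactOperator (π p) := by
    intro hc
    apply hπ
    have := aux_compact (π p) (π v) (π (star v)) hc (by rw [← map_mul, hp_idem])
      (by rw [← map_mul, hv]) (by rw [← map_mul, hvp]) (by rw [← map_mul, hpv])
      (by rw [← map_mul, ← map_mul, hsub])
    rw [map_sub, map_mul, this, sub_self]
  exact ⟨⟨H, i1, i2, i3, π, hirr, p, hnc⟩, fun h => hnc (h H i1 i2 i3 π hirr p)⟩
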